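/- arXiv:2506.04087 — 3 statements merged into one kernel-verified Lean document; each statement's English description precedes it below -/
import Mathlib

section
/- Let p be a prime with p ≡ 1 (mod 4), let c be an integer with gcd(c, p) = 1, and let L be a positive integer with L < n_p, where n_p is the least positive quadratic non-residue modulo p. Suppose that for every integer l with 1 ≤ l ≤ L one has ((l − 4c)/p) = ((l + 4c)/p) = −1. Then for all nonzero integers h, k with |h·k| ≤ L, the product of Legendre symbols satisfies ((h·k)/p)·((h·k − 4c)/p) = −1; consequently, for every pair of integers X, Y with 0 ≤ X, Y ≤ p − 1, the square B_{X,Y}(√L) contains at most one point of the modular hyperbola H_p^c. -/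
/-- The modular hyperbola `H_p^c`: pairs `(x, y)` with `0 ≤ x, y ≤ p - 1` and
`x * y ≡ c (mod p)`. -/
def ModularHyperbola (p : ℕ) (c : ℤ) : Set (ℤ × ℤ) :=
  {q : ℤ × ℤ | 0 ≤ q.1 ∧ q.1 ≤ (p : ℤ) - 1 ∧ 0 ≤ q.2 ∧ q.2 ≤ (p : ℤ) - 1 ∧
    q.1 * q.2 ≡ c [ZMOD (p : ℤ)]}

/-- The square `B_{X,Y}(H)`: pairs `(x, y)` with `0 ≤ x, y ≤ p - 1` such that
`x ≡ X + i (mod p)` and `y ≡ Y + j (mod p)` for some integers `0 ≤ i, j ≤ H`. -/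
def SquareBox (p : ℕ) (X Y : ℤ) (H : ℝ) : Set (ℤ × ℤ) :=
  {q : ℤ × ℤ | 0 ≤ q.1 ∧ q.1 ≤ (p : ℤ) - 1 ∧ 0 ≤ q.2 ∧ q.2 ≤ (p : ℤ) - 1 ∧
    ∃ i j : ℤ, 0 ≤ i ∧ (i : ℝ) ≤ H ∧ 0 ≤ j ∧ (j : ℝ) ≤ H ∧
      q.1 ≡ X + i [ZMOD (p : ℤ)] ∧ q.2 ≡ Y + j [ZMOD (p : ℤ)]}

/-- If `p ≡ 1 (mod 4)`, the Legendre symbol mod `p` is an even function. -/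
theorem legendreSym_neg_of_mod_four_eq_one {p : ℕ} [Fact p.Prime] (hp4 : p % 4 = 1) (a : ℤ) :
    legendreSym p (-a) = legendreSym p a := by
  have h1 : legendreSym p (-1) = 1 := by
    rw [legendreSym.at_neg_one (by omega), ZMod.χ₄_nat_one_mod_four hp4]
  rw [← neg_one_mul, legendreSym.mul, h1, one_mul]

theorem legendreSym_congr {p : ℕ} [Fact p.Prime] {a b : ℤ} (h : a ≡ b [ZMOD p]) :
    legendreSym p a = legendreSym p b := by
  rw [legendreSym.mod p a, legendreSym.mod p b, h]

/-- Positive integers below the least quadratic non-residue are quadratic residues. -/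
theorem legendreSym_eq_one_of_lt_least_nonresidue {p : ℕ} [Fact p.Prime] {np : ℕ}
    (hnp : IsLeast {n : ℕ | 0 < n ∧ legendreSym p (n : ℤ) = -1} np)
    {l : ℕ} (hl : 0 < l) (hlt : l < np) : legendreSym p (l : ℤ) = 1 := by
  have hp : 0 < p := (Fact.out : p.Prime).pos
  have hmod : legendreSym p ((np % p : ℕ) : ℤ) = -1 := by
    rw [Int.natCast_mod, ← legendreSym.mod]
    exact hnp.1.2
  have hpos : 0 < np % p := by
    rcases Nat.eq_zero_or_pos (np % p) with h | h
    · rw [h, Nat.cast_zero, legendreSym.at_zero] at hmod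
      norm_num at hmod
    · exact h
  have hle : np ≤ np % p := hnp.2 ⟨hpos, hmod⟩
  have hltp : l < p := hlt.trans (hle.trans_lt (Nat.mod_lt _ hp))
  have hne : ((l : ℤ) : ZMod p) ≠ 0 := by
    rw [Int.cast_natCast, Ne, ZMod.natCast_eq_zero_iff]
    exact fun h => absurd (Nat.le_of_dvd hl h) (by omega)
  rcases legendreSym.eq_one_or_neg_one p hne with h | h
  · exact h
  · exact absurd (hnp.2 ⟨hl, h⟩) (by omega)

/-- Integers in `[0, p - 1]` that are congruent mod `p` are equal. -/
theorem Int.ModEq.eq_of_mem_range {p a b : ℤ} (h : a ≡ b [ZMOD p]) (ha : 0 ≤ a) (ha' : a ≤ p - 1)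
    (hb : 0 ≤ b) (hb' : b ≤ p - 1) : a = b := by
  rw [Int.ModEq, Int.emod_eq_of_lt ha (by omega), Int.emod_eq_of_lt hb (by omega)] at h
  exact h

theorem Int.ModEq.cancel_left_of_mul_modEq {p : ℕ} [Fact p.Prime] {c x y z : ℤ}
    (hc : Int.gcd c p = 1) (hy : x * y ≡ c [ZMOD p]) (hz : x * z ≡ c [ZMOD p]) :
    y ≡ z [ZMOD p] := by
  have hxp : Int.gcd (p : ℤ) x = 1 := by
    have h1 : Int.gcd (x * y) p = 1 := by
      rw [← Int.gcd_emod, hy, Int.gcd_emod, hc]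
    exact (Int.isCoprime_iff_gcd_eq_one.mp
      (Int.isCoprime_iff_gcd_eq_one.mpr h1).of_mul_left_left.symm)
  have h := Int.ModEq.cancel_left_div_gcd (by exact_mod_cast (Fact.out : p.Prime).pos)
    (hy.trans hz.symm)
  simpa [hxp] using h

/-- If `(x, y)` and `(x + h, y + k)` lie on the hyperbola `x * y ≡ c (mod p)`, then the
discriminant `hk (hk - 4c)` is a square mod `p`. -/
theorem discrim_modEq_sq_of_mul_modEq {p c x y h k : ℤ} (h1 : x * y ≡ c [ZMOD p])
    (h2 : (x + h) * (y + k) ≡ c [ZMOD p]) :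
    (h * k) * (h * k - 4 * c) ≡ (2 * k * x + h * k) * (2 * k * x + h * k) [ZMOD p] := by
  obtain ⟨u, hu⟩ := h1.dvd
  obtain ⟨v, hv⟩ := h2.dvd
  refine (Int.modEq_iff_dvd).mpr ⟨4 * k * (h * u + x * u - x * v), ?_⟩
  linear_combination 4 * k * (h + x) * hu - 4 * k * x * hv

theorem abs_mul_le_of_cast_le_sqrt {L : ℕ} {i₁ i₂ j₁ j₂ : ℤ}
    (hi₁ : 0 ≤ i₁) (hi₁' : (i₁ : ℝ) ≤ √L) (hi₂ : 0 ≤ i₂) (hi₂' : (i₂ : ℝ) ≤ √L)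
    (hj₁ : 0 ≤ j₁) (hj₁' : (j₁ : ℝ) ≤ √L) (hj₂ : 0 ≤ j₂) (hj₂' : (j₂ : ℝ) ≤ √L) :
    |(i₂ - i₁) * (j₂ - j₁)| ≤ (L : ℤ) := by
  rify at hi₁ hi₂ hj₁ hj₂ ⊢
  calc |((i₂ : ℝ) - i₁) * (j₂ - j₁)| = |(i₂ : ℝ) - i₁| * |(j₂ : ℝ) - j₁| := abs_mul _ _
    _ ≤ √L * √L := mul_le_mul (abs_le.mpr ⟨by linarith, by linarith⟩)
        (abs_le.mpr ⟨by linarith, by linarith⟩) (abs_nonneg _) (Real.sqrt_nonneg _)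
    _ = L := Real.mul_self_sqrt (Nat.cast_nonneg L)

/-- Let `p ≡ 1 (mod 4)` be prime, `gcd(c, p) = 1`, and `0 < L < n_p` where `n_p` is the least
positive quadratic non-residue mod `p`. If `((l - 4c)/p) = ((l + 4c)/p) = -1` for all
`1 ≤ l ≤ L`, then `((hk)/p)((hk - 4c)/p) = -1` for all nonzero `h, k` with `|hk| ≤ L`;
consequently every square of side `√L` contains at most one point of `H_p^c`. -/
theorem legendre_prod_neg_one_and_squares_isolated (p : ℕ) [Fact p.Prime]
    (hp4 : p % 4 = 1) (c : ℤ) (hc : Int.gcd c (p : ℤ) = 1)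
    (L : ℕ) (hL : 0 < L) (np : ℕ)
    (hnp : IsLeast {n : ℕ | 0 < n ∧ legendreSym p (n : ℤ) = -1} np) (hLnp : L < np)
    (hleg : ∀ l : ℤ, 1 ≤ l → l ≤ (L : ℤ) →
      legendreSym p (l - 4 * c) = -1 ∧ legendreSym p (l + 4 * c) = -1) :
    (∀ h k : ℤ, h ≠ 0 → k ≠ 0 → |h * k| ≤ (L : ℤ) →
      legendreSym p (h * k) * legendreSym p (h * k - 4 * c) = -1) ∧
    (∀ X Y : ℤ, 0 ≤ X → X ≤ (p : ℤ) - 1 → 0 ≤ Y → Y ≤ (p : ℤ) - 1 →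
      (ModularHyperbola p c ∩ SquareBox p X Y (Real.sqrt L)).Subsingleton) := by
  have key : ∀ h k : ℤ, h ≠ 0 → k ≠ 0 → |h * k| ≤ (L : ℤ) →
      legendreSym p (h * k) * legendreSym p (h * k - 4 * c) = -1 := by
    intro h k hh hk hle
    have hm : h * k ≠ 0 := mul_ne_zero hh hk
    generalize h * k = m at hm hle
    obtain ⟨l, hl | hl⟩ := m.eq_nat_or_neg
    · subst hl
      rw [Nat.abs_cast] at hle
      rw [legendreSym_eq_one_of_lt_least_nonresidue hnp (by omega) (by omega),
        (hleg l (by omega) hle).1, one_mul]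
    · subst hl
      rw [abs_neg, Nat.abs_cast] at hle
      rw [← neg_add', legendreSym_neg_of_mod_four_eq_one hp4,
        legendreSym_neg_of_mod_four_eq_one hp4,
        legendreSym_eq_one_of_lt_least_nonresidue hnp (by omega) (by omega),
        (hleg l (by omega) hle).2, one_mul]
  refine ⟨key, ?_⟩
  rintro X Y - - - -
  rintro ⟨x₁, y₁⟩ ⟨⟨hx₁, hx₁', hy₁, hy₁', hc₁⟩, -, -, -, -, i₁, j₁, hi₁, hi₁', hj₁, hj₁', hX₁, hY₁⟩
    ⟨x₂, y₂⟩ ⟨⟨hx₂, hx₂', hy₂, hy₂', hc₂⟩, -, -, -, -, i₂, j₂, hi₂, hi₂', hj₂, hj₂', hX₂, hY₂⟩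
  dsimp only at *
  have hx : x₂ ≡ x₁ + (i₂ - i₁) [ZMOD p] := by
    refine hX₂.trans ?_
    simpa [add_assoc] using (hX₁.add_right (i₂ - i₁)).symm
  have hy : y₂ ≡ y₁ + (j₂ - j₁) [ZMOD p] := by
    refine hY₂.trans ?_
    simpa [add_assoc] using (hY₁.add_right (j₂ - j₁)).symm
  by_cases hi : i₂ - i₁ = 0
  · rw [hi, add_zero] at hx
    obtain rfl := hx.eq_of_mem_range hx₂ hx₂' hx₁ hx₁'
    rw [(Int.ModEq.cancel_left_of_mul_modEq hc hc₁ hc₂).eq_of_mem_range hy₁ hy₁' hy₂ hy₂']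
  by_cases hj : j₂ - j₁ = 0
  · rw [hj, add_zero] at hy
    obtain rfl := hy.eq_of_mem_range hy₂ hy₂' hy₁ hy₁'
    rw [mul_comm] at hc₁ hc₂
    rw [(Int.ModEq.cancel_left_of_mul_modEq hc hc₁ hc₂).eq_of_mem_range hx₁ hx₁' hx₂ hx₂']
  have hneg := key _ _ hi hj
    (abs_mul_le_of_cast_le_sqrt hi₁ hi₁' hi₂ hi₂' hj₁ hj₁' hj₂ hj₂')
  rw [← legendreSym.mul, legendreSym_congr
    (discrim_modEq_sq_of_mul_modEq hc₁ ((hx.mul hy).symm.trans hc₂)), legendreSym.mul] at hneg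
  exact absurd (mul_self_nonneg (legendreSym p _)) (by rw [hneg]; norm_num)
end

section
/- There exists an absolute constant C > 0 such that for every real H ≥ 2 and every pair of finite sets A, Z of positive integers contained in [1, H], the number of quadruples (h₁, h₂, z₁, z₂) ∈ A × A × Z × Z with h₁·z₁ = h₂·z₂ is at most C·H²·log H. -/
/-- Every solution of `h₁ z₁ = h₂ z₂` in `[1, N]` has the form `(g a, g b, k b, k a)` with
`g, k ≤ N / max a b`. -/
lemma card_mul_eq_mul_le_sum (N : ℕ) (A Z : Finset ℕ)
    (hA : ∀ a ∈ A, 1 ≤ a ∧ a ≤ N) (hZ : ∀ z ∈ Z, 1 ≤ z ∧ z ≤ N) :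
    (((A ×ˢ A) ×ˢ (Z ×ˢ Z)).filter (fun q => q.1.1 * q.2.1 = q.1.2 * q.2.2)).card ≤
      ∑ p ∈ Finset.Icc 1 N ×ˢ Finset.Icc 1 N, (N / max p.1 p.2) ^ 2 := by
  classical
  let S : Finset (Σ _ : ℕ × ℕ, ℕ × ℕ) := (Finset.Icc 1 N ×ˢ Finset.Icc 1 N).sigma
    fun p => Finset.Icc 1 (N / max p.1 p.2) ×ˢ Finset.Icc 1 (N / max p.1 p.2)
  have hS : S.card = ∑ p ∈ Finset.Icc 1 N ×ˢ Finset.Icc 1 N, (N / max p.1 p.2) ^ 2 := by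
    simp [S, Finset.card_sigma, sq]
  rw [← hS]
  let f : (Σ _ : ℕ × ℕ, ℕ × ℕ) → (ℕ × ℕ) × (ℕ × ℕ) := fun s =>
    ((s.2.1 * s.1.1, s.2.1 * s.1.2), (s.2.2 * s.1.2, s.2.2 * s.1.1))
  refine (Finset.card_le_card (t := S.image f) ?_).trans Finset.card_image_le
  rintro ⟨⟨h₁, h₂⟩, ⟨z₁, z₂⟩⟩ hq
  simp only [Finset.mem_filter, Finset.mem_product] at hq
  obtain ⟨⟨⟨hh₁, hh₂⟩, hz₁, hz₂⟩, heq⟩ := hq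
  have bh₁ := hA _ hh₁
  have bh₂ := hA _ hh₂
  have bz₁ := hZ _ hz₁
  have bz₂ := hZ _ hz₂
  obtain ⟨g, a, b, hg, hab, rfl, rfl⟩ := Nat.exists_coprime' (Nat.gcd_pos_of_pos_left h₂ bh₁.1)
  have heq' : a * z₁ = b * z₂ := by
    apply Nat.eq_of_mul_eq_mul_left hg
    linarith
  obtain ⟨k, rfl⟩ : b ∣ z₁ := hab.symm.dvd_of_dvd_mul_left ⟨z₂, heq'⟩
  have ha : 0 < a := Nat.pos_of_mul_pos_right bh₁.1
  have hb : 0 < b := Nat.pos_of_mul_pos_right bh₂.1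
  have hk : 0 < k := Nat.pos_of_mul_pos_left bz₁.1
  obtain rfl : z₂ = a * k := by
    apply Nat.eq_of_mul_eq_mul_left hb
    linarith
  have hm : 0 < max a b := lt_max_of_lt_left ha
  refine Finset.mem_image.2 ⟨⟨(a, b), (g, k)⟩, ?_, ?_⟩
  · simp only [S, Finset.mem_sigma, Finset.mem_product, Finset.mem_Icc,
      Nat.le_div_iff_mul_le hm]
    refine ⟨⟨⟨ha, by nlinarith⟩, hb, by nlinarith⟩, ⟨hg, ?_⟩, hk, ?_⟩
    · rcases max_choice a b with h | h <;> rw [h] <;> linarith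
    · rcases max_choice a b with h | h <;> rw [h] <;> linarith
  · simp only [f, Prod.mk.injEq]
    refine ⟨⟨?_, ?_⟩, ?_, ?_⟩ <;> ring

lemma sum_inv_max_sq_le_two_mul_harmonic (N : ℕ) :
    ∑ p ∈ Finset.Icc 1 N ×ˢ Finset.Icc 1 N, (((max p.1 p.2 : ℕ) : ℝ) ^ 2)⁻¹ ≤
      2 * (harmonic N : ℝ) := by
  have key : ∑ a ∈ Finset.Icc 1 N, ∑ b ∈ Finset.Icc 1 N,
      (if b ≤ a then ((a : ℝ) ^ 2)⁻¹ else 0) ≤ (harmonic N : ℝ) := by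
    rw [harmonic_eq_sum_Icc]
    push_cast
    refine Finset.sum_le_sum fun a ha => ?_
    have ha0 : (0 : ℝ) < a := by exact_mod_cast (Finset.mem_Icc.1 ha).1
    rw [← Finset.sum_filter, Finset.sum_const, nsmul_eq_mul]
    have hc : ((Finset.Icc 1 N).filter (· ≤ a)).card ≤ a := by
      calc _ ≤ (Finset.Icc 1 a).card := Finset.card_le_card fun b hb => by
              simp only [Finset.mem_filter, Finset.mem_Icc] at hb ⊢
              exact ⟨hb.1.1, hb.2⟩
        _ = a := by simp
    calc _ ≤ (a : ℝ) * ((a : ℝ) ^ 2)⁻¹ := by gcongr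
      _ = (a : ℝ)⁻¹ := by field_simp
  rw [Finset.sum_product]
  calc _ ≤ ∑ a ∈ Finset.Icc 1 N, ∑ b ∈ Finset.Icc 1 N,
        ((if b ≤ a then ((a : ℝ) ^ 2)⁻¹ else 0) + (if a ≤ b then ((b : ℝ) ^ 2)⁻¹ else 0)) := by
        refine Finset.sum_le_sum fun a _ => Finset.sum_le_sum fun b _ => ?_
        rcases le_total a b with h | h
        · simp only [max_eq_right h, h, if_true]
          exact le_add_of_nonneg_left (by positivity)
        · simp only [max_eq_left h, h, if_true]
          exact le_add_of_nonneg_right (by positivity)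
    _ = 2 * ∑ a ∈ Finset.Icc 1 N, ∑ b ∈ Finset.Icc 1 N,
        (if b ≤ a then ((a : ℝ) ^ 2)⁻¹ else 0) := by
        simp only [Finset.sum_add_distrib]
        rw [two_mul]
        congr 1
        exact Finset.sum_comm
    _ ≤ _ := by gcongr

/-- There is an absolute constant `C > 0` such that for every real `H ≥ 2` and finite sets
`A, Z` of positive integers in `[1, H]`, the number of quadruples
`(h₁, h₂, z₁, z₂) ∈ A × A × Z × Z` with `h₁ z₁ = h₂ z₂` is at most `C H² log H`. -/
theorem multiplicative_energy_bound :
    ∃ C : ℝ, 0 < C ∧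
      ∀ H : ℝ, 2 ≤ H → ∀ A Z : Finset ℕ,
        (∀ a ∈ A, 1 ≤ a ∧ (a : ℝ) ≤ H) → (∀ z ∈ Z, 1 ≤ z ∧ (z : ℝ) ≤ H) →
        ((((A ×ˢ A) ×ˢ (Z ×ˢ Z)).filter
            (fun q => q.1.1 * q.2.1 = q.1.2 * q.2.2)).card : ℝ) ≤
          C * H ^ 2 * Real.log H := by
  refine ⟨6, by norm_num, fun H hH A Z hA hZ => ?_⟩
  have hH0 : 0 ≤ H := by linarith
  set N := ⌊H⌋₊
  have hNH : (N : ℝ) ≤ H := Nat.floor_le hH0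
  have hN : 0 < N := Nat.floor_pos.2 (by linarith)
  have hcard := card_mul_eq_mul_le_sum N A Z
    (fun a ha => ⟨(hA a ha).1, Nat.le_floor (hA a ha).2⟩)
    (fun z hz => ⟨(hZ z hz).1, Nat.le_floor (hZ z hz).2⟩)
  have hlog : Real.log N ≤ Real.log H := Real.log_le_log (by exact_mod_cast hN) hNH
  have hlog_two : Real.log 2 ≤ Real.log H := Real.log_le_log (by norm_num) hH
  have hharm := harmonic_le_one_add_log N
  have hbound : 2 * (harmonic N : ℝ) ≤ 6 * Real.log H := by
    linarith [Real.log_two_gt_d9]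
  calc _ ≤ ((∑ p ∈ Finset.Icc 1 N ×ˢ Finset.Icc 1 N, (N / max p.1 p.2) ^ 2 : ℕ) : ℝ) := by
        exact_mod_cast hcard
    _ ≤ ∑ p ∈ Finset.Icc 1 N ×ˢ Finset.Icc 1 N,
        (N : ℝ) ^ 2 * (((max p.1 p.2 : ℕ) : ℝ) ^ 2)⁻¹ := by
        rw [Nat.cast_sum]
        refine Finset.sum_le_sum fun p _ => ?_
        rw [Nat.cast_pow, ← div_eq_mul_inv, ← div_pow]
        gcongr
        exact Nat.cast_div_le
    _ ≤ H ^ 2 * (6 * Real.log H) := by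
        rw [← Finset.mul_sum]
        have hsum := (sum_inv_max_sq_le_two_mul_harmonic N).trans hbound
        gcongr
    _ = 6 * H ^ 2 * Real.log H := by ring
end

section
/- Let p be an odd prime, let Z be a finite set of integers lying in distinct residue classes modulo p, and let R be a positive integer. Then the 2R-th moment of the incomplete quadratic character sum satisfies: ∑_{n=1}^{p} ( ∑_{z ∈ Z} ((n − z)/p) )^{2R} ≤ ((2R)! / (2^R · R!)) · |Z|^R · p + 2R · |Z|^{2R} · √p. -/
open Polynomial

/-- The derivation `2 y d/dx` of the coordinate ring of `y² = F(x)`. -/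
noncomputable def hyperellipticDeriv {K : Type*} [Field K] (F : K[X]) :
    QuadraticAlgebra K[X] F 0 →ₗ[K] QuadraticAlgebra K[X] F 0 where
  toFun h := ⟨2 * F * derivative h.im + derivative F * h.im, 2 * derivative h.re⟩
  map_add' a b := by ext1 <;> simp <;> ring
  map_smul' c a := by ext1 <;> simp [smul_eq_C_mul] <;> ring

/-- The functions on `y² = F(x)`, where `F` has degree `2 * g + 1`, that are regular away from
infinity and have a pole of order at most `n` there. -/
def poleSpace {K : Type*} [Field K] (F : K[X]) (g n : ℕ) :
    Submodule K (QuadraticAlgebra K[X] F 0) where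
  carrier := {h | h.re ∈ degreeLT K (n / 2 + 1) ∧ h.im ∈ degreeLT K ((n + 1) / 2 - g)}
  add_mem' ha hb := ⟨add_mem ha.1 hb.1, add_mem ha.2 hb.2⟩
  zero_mem' := ⟨zero_mem _, zero_mem _⟩
  smul_mem' c _ ha := ⟨Submodule.smul_mem _ c ha.1, Submodule.smul_mem _ c ha.2⟩

section Hyperelliptic

variable {K : Type*} [Field K] {F : K[X]}

@[simp]
lemma hyperellipticDeriv_re (h : QuadraticAlgebra K[X] F 0) :
    (hyperellipticDeriv F h).re = 2 * F * derivative h.im + derivative F * h.im := rfl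

@[simp]
lemma hyperellipticDeriv_im (h : QuadraticAlgebra K[X] F 0) :
    (hyperellipticDeriv F h).im = 2 * derivative h.re := rfl

lemma hyperellipticDeriv_mul (a b : QuadraticAlgebra K[X] F 0) :
    hyperellipticDeriv F (a * b) = a * hyperellipticDeriv F b + hyperellipticDeriv F a * b := by
  ext1 <;> simp [derivative_mul] <;> ring

lemma hyperellipticDeriv_pow_char (p : ℕ) [CharP K p]
    (a : QuadraticAlgebra K[X] F 0) : hyperellipticDeriv F (a ^ p) = 0 := by
  have key : ∀ n : ℕ, hyperellipticDeriv F (a ^ n) =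
      algebraMap K[X] _ (n : K[X]) * a ^ (n - 1) * hyperellipticDeriv F a := by
    intro n
    induction n with
    | zero => ext1 <;> simp [QuadraticAlgebra.re_one, QuadraticAlgebra.im_one]
    | succ n ih =>
      rw [pow_succ, hyperellipticDeriv_mul, ih]
      rcases n with - | n
      · simp
      · simp only [Nat.add_sub_cancel, pow_succ, map_natCast]
        push_cast
        ring
  rw [key, CharP.cast_eq_zero]
  simp

lemma iterate_hyperellipticDeriv_mul_pow (p : ℕ) [CharP K p]
    (a b : QuadraticAlgebra K[X] F 0) (l : ℕ) :
    (hyperellipticDeriv F ^ l) (a * b ^ p) = (hyperellipticDeriv F ^ l) a * b ^ p := by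
  induction l with
  | zero => simp
  | succ l ih =>
    rw [pow_succ', Module.End.mul_apply, ih, hyperellipticDeriv_mul,
      hyperellipticDeriv_pow_char p]
    simp [Module.End.mul_apply]

/-- Iterating the derivation `l` times on an element of order `l` along `x = x₀` extracts its
leading coefficient. -/
lemma iterate_hyperellipticDeriv_leading (x₀ : K) (l : ℕ) (w : QuadraticAlgebra K[X] F 0) :
    algebraMap K[X] _ (X - C x₀) ∣
      (hyperellipticDeriv F ^ l) (algebraMap K[X] _ (X - C x₀) ^ l * w) -
        algebraMap K[X] _ ((l.factorial : K[X]) * 2 ^ l) * QuadraticAlgebra.omega ^ l * w := by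
  induction l generalizing w with
  | zero => simp
  | succ l ih =>
    have hπ : hyperellipticDeriv F (algebraMap K[X] _ (X - C x₀)) =
        algebraMap K[X] _ 2 * QuadraticAlgebra.omega := by
      ext1 <;> simp
    have hpow : ∀ n : ℕ, hyperellipticDeriv F (algebraMap K[X] _ (X - C x₀) ^ (n + 1)) =
        algebraMap K[X] _ ((n + 1 : ℕ) : K[X]) * algebraMap K[X] _ (X - C x₀) ^ n *
          (algebraMap K[X] _ 2 * QuadraticAlgebra.omega) := by
      intro n
      induction n with
      | zero => rw [zero_add, pow_one, hπ]; simp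
      | succ n ihn =>
        rw [pow_succ, hyperellipticDeriv_mul, ihn, hπ]
        simp only [map_natCast]
        push_cast
        ring
    set π : QuadraticAlgebra K[X] F 0 := algebraMap K[X] _ (X - C x₀) with hπdef
    have h1 : hyperellipticDeriv F (π ^ (l + 1) * w) = π ^ l * (π * hyperellipticDeriv F w +
        algebraMap K[X] _ ((l + 1 : ℕ) : K[X]) *
          (algebraMap K[X] _ 2 * QuadraticAlgebra.omega) * w) := by
      rw [hyperellipticDeriv_mul, hpow]
      ring
    rw [pow_succ, Module.End.mul_apply, h1]
    have h2 := ih (π * hyperellipticDeriv F w +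
        algebraMap K[X] _ ((l + 1 : ℕ) : K[X]) *
          (algebraMap K[X] _ 2 * QuadraticAlgebra.omega) * w)
    have h3 : π ∣ π * (algebraMap K[X] _ ((l.factorial : K[X]) * 2 ^ l) *
      QuadraticAlgebra.omega ^ l * hyperellipticDeriv F w) := dvd_mul_right _ _
    have h4 := dvd_add h2 h3
    convert h4 using 1
    rw [Nat.factorial_succ]
    simp only [map_mul, map_natCast, map_pow]
    push_cast
    ring

lemma X_sub_C_dvd_of_dvd_algebraMap_mul {x₀ : K} {c : K[X]} (hc : c.eval x₀ ≠ 0)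
    {w : QuadraticAlgebra K[X] F 0}
    (h : algebraMap K[X] _ (X - C x₀) ∣ algebraMap K[X] _ c * w) :
    algebraMap K[X] _ (X - C x₀) ∣ w := by
  have hco : IsCoprime (X - C x₀) c := by
    refine ((irreducible_X_sub_C x₀).coprime_iff_not_dvd).2 fun h => hc ?_
    exact (dvd_iff_isRoot.1 h)
  exact (hco.map (algebraMap K[X] (QuadraticAlgebra K[X] F 0))).dvd_of_dvd_mul_left h

lemma X_sub_C_pow_dvd_of_iterate (p : ℕ) [Fact p.Prime] [CharP K p] (hp : 2 < p) {x₀ : K}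
    (hF : F.eval x₀ ≠ 0) {M : ℕ} (hM : M ≤ p) {h : QuadraticAlgebra K[X] F 0}
    (hh : ∀ l < M, algebraMap K[X] _ (X - C x₀) ∣ (hyperellipticDeriv F ^ l) h) :
    algebraMap K[X] _ (X - C x₀) ^ M ∣ h := by
  suffices ∀ l ≤ M, algebraMap K[X] _ (X - C x₀) ^ l ∣ h from this M le_rfl
  intro l
  induction l with
  | zero => simp
  | succ l ih =>
    intro hl
    obtain ⟨w, rfl⟩ := ih (by omega)
    rw [pow_succ]
    refine mul_dvd_mul_left _ ?_
    have h1 := (dvd_sub_right (hh l (by omega))).1 (iterate_hyperellipticDeriv_leading x₀ l w)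
    have h2 := h1.mul_left (QuadraticAlgebra.omega ^ l)
    have h3 : (QuadraticAlgebra.omega : QuadraticAlgebra K[X] F 0) ^ l *
        QuadraticAlgebra.omega ^ l = algebraMap K[X] _ (F ^ l) := by
      rw [← mul_pow, QuadraticAlgebra.omega_mul_omega_eq_mk, map_pow]; rfl
    refine X_sub_C_dvd_of_dvd_algebraMap_mul (c := (l.factorial : K[X]) * 2 ^ l * F ^ l) ?_ ?_
    · have hfac : ((l.factorial : ℕ) : K) ≠ 0 := by
        rw [Ne, CharP.cast_eq_zero_iff K p, (Fact.out : p.Prime).dvd_factorial]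
        omega
      have htwo : (2 : K) ≠ 0 := by
        have : ((2 : ℕ) : K) ≠ 0 := by
          rw [Ne, CharP.cast_eq_zero_iff K p]
          exact fun h => absurd (Nat.le_of_dvd (by norm_num) h) (by omega)
        simpa using this
      simp [hfac, htwo, hF]
    · convert h2 using 1
      rw [map_mul _ _ (F ^ l), ← h3]
      ring

end Hyperelliptic

section PoleSpace

variable {K : Type*} [Field K] {F : K[X]} {g : ℕ}

lemma mem_poleSpace_iff_degree_norm_le (hF : F.natDegree = 2 * g + 1) {n : ℕ}
    {h : QuadraticAlgebra K[X] F 0} : h ∈ poleSpace F g n ↔ h.norm.degree ≤ n := by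
  have hF0 : F ≠ 0 := by rintro rfl; simp at hF
  have hmem : h ∈ poleSpace F g n ↔
      h.re ∈ degreeLT K (n / 2 + 1) ∧ h.im ∈ degreeLT K ((n + 1) / 2 - g) := Iff.rfl
  rw [hmem, mem_degreeLT, mem_degreeLT, QuadraticAlgebra.norm_def]
  obtain ⟨u, v⟩ := h
  simp only [zero_mul, add_zero]
  by_cases hu : u = 0 <;> by_cases hv : v = 0
  · simp [hu, hv]
  · have hd : (F * v * v).natDegree = 2 * g + 1 + 2 * v.natDegree := by
      rw [natDegree_mul (mul_ne_zero hF0 hv) hv, natDegree_mul hF0 hv]; omega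
    have hne : F * v * v ≠ 0 := mul_ne_zero (mul_ne_zero hF0 hv) hv
    simp only [hu, zero_mul, zero_sub, degree_neg, degree_zero]
    rw [degree_eq_natDegree hne, degree_eq_natDegree hv, hd]
    simp only [WithBot.bot_lt_natCast, true_and, Nat.cast_lt, Nat.cast_le]
    omega
  · have hd : (u * u).natDegree = 2 * u.natDegree := by
      rw [natDegree_mul hu hu]; omega
    simp only [hv, mul_zero, sub_zero, degree_zero]
    rw [degree_eq_natDegree (mul_ne_zero hu hu), degree_eq_natDegree hu, hd]
    simp only [WithBot.bot_lt_natCast, and_true, Nat.cast_lt, Nat.cast_le]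
    omega
  · have hd1 : (u * u).natDegree = 2 * u.natDegree := by
      rw [natDegree_mul hu hu]; omega
    have hd2 : (F * v * v).natDegree = 2 * g + 1 + 2 * v.natDegree := by
      rw [natDegree_mul (mul_ne_zero hF0 hv) hv, natDegree_mul hF0 hv]; omega
    have e1 : (u * u).degree = ((2 * u.natDegree : ℕ) : WithBot ℕ) := by
      rw [degree_eq_natDegree (mul_ne_zero hu hu), hd1]
    have e2 : (F * v * v).degree = ((2 * g + 1 + 2 * v.natDegree : ℕ) : WithBot ℕ) := by
      rw [degree_eq_natDegree (mul_ne_zero (mul_ne_zero hF0 hv) hv), hd2]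
    rw [degree_eq_natDegree hu, degree_eq_natDegree hv]
    rcases lt_or_gt_of_ne (show 2 * u.natDegree ≠ 2 * g + 1 + 2 * v.natDegree by omega)
      with hlt | hlt
    · rw [degree_sub_eq_right_of_degree_lt (by rw [e1, e2]; exact_mod_cast hlt), e2]
      simp only [Nat.cast_lt, Nat.cast_le]
      omega
    · rw [degree_sub_eq_left_of_degree_lt (by rw [e1, e2]; exact_mod_cast hlt), e1]
      simp only [Nat.cast_lt, Nat.cast_le]
      omega

lemma norm_ne_zero_of_odd_natDegree (hF : F.natDegree = 2 * g + 1)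
    {h : QuadraticAlgebra K[X] F 0} (hh : h ≠ 0) : h.norm ≠ 0 := by
  intro h0
  have hF0 : F ≠ 0 := by rintro rfl; simp at hF
  rw [QuadraticAlgebra.norm_def, zero_mul, zero_mul, add_zero, sub_eq_zero] at h0
  have hdeg := congrArg natDegree h0
  by_cases hv : h.im = 0
  · simp only [hv, mul_zero, mul_self_eq_zero] at h0
    exact hh (by ext1 <;> simp [hv, h0])
  · by_cases hu : h.re = 0
    · simp [hu, hv, hF0] at h0
    · rw [natDegree_mul hu hu, natDegree_mul (mul_ne_zero hF0 hv) hv, natDegree_mul hF0 hv] at hdeg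
      omega

lemma mem_poleSpace_iff_natDegree_norm_le (hF : F.natDegree = 2 * g + 1) {n : ℕ}
    {h : QuadraticAlgebra K[X] F 0} : h ∈ poleSpace F g n ↔ h.norm.natDegree ≤ n := by
  rw [mem_poleSpace_iff_degree_norm_le hF, natDegree_le_iff_degree_le]

lemma mul_mem_poleSpace (hF : F.natDegree = 2 * g + 1) {m n : ℕ}
    {a b : QuadraticAlgebra K[X] F 0} (ha : a ∈ poleSpace F g m) (hb : b ∈ poleSpace F g n) :
    a * b ∈ poleSpace F g (m + n) := by
  rw [mem_poleSpace_iff_natDegree_norm_le hF] at *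
  rw [map_mul]
  exact natDegree_mul_le.trans (by omega)

lemma degree_derivative_lt_pred {u : K[X]} {n : ℕ} (hu : u.degree < (n + 1 : ℕ)) :
    (derivative u).degree < n := by
  by_cases h0 : u = 0
  · simp [h0]
  · have := degree_derivative_lt h0
    rw [degree_eq_natDegree h0] at this hu
    exact this.trans_le (by exact_mod_cast Nat.lt_succ_iff.1 (by exact_mod_cast hu))

lemma hyperellipticDeriv_mem_poleSpace (hF : F.natDegree = 2 * g + 1) (hg : 1 ≤ g) {n : ℕ}
    {h : QuadraticAlgebra K[X] F 0} (hh : h ∈ poleSpace F g n) :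
    hyperellipticDeriv F h ∈ poleSpace F g (n + (2 * g - 1)) := by
  have hF0 : F ≠ 0 := by rintro rfl; simp at hF
  obtain ⟨h1, h2⟩ := hh
  rw [mem_degreeLT] at h1 h2
  have hC : ∀ q : K[X], (2 * q).degree ≤ q.degree := fun q => by
    rw [two_mul]; exact (degree_add_le _ _).trans (by simp)
  refine ⟨?_, ?_⟩ <;> rw [mem_degreeLT]
  · rw [hyperellipticDeriv_re]
    by_cases h0 : h.im = 0
    · simp [h0]
    have hpos : 0 < (n + 1) / 2 - g := by
      by_contra hcon
      rw [degree_eq_natDegree h0, Nat.cast_lt] at h2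
      omega
    have h3 : h.im.natDegree + 1 ≤ (n + 1) / 2 - g := by
      rw [degree_eq_natDegree h0, Nat.cast_lt] at h2
      omega
    refine (degree_add_le _ _).trans_lt (max_lt ?_ ?_)
    · rw [mul_assoc]
      refine (hC _).trans_lt ?_
      by_cases h4 : derivative h.im = 0
      · rw [h4, mul_zero, degree_zero]; exact WithBot.bot_lt_coe _
      have h5 := degree_derivative_lt h0
      rw [degree_eq_natDegree h4, degree_eq_natDegree h0, Nat.cast_lt] at h5
      rw [degree_eq_natDegree (mul_ne_zero hF0 h4), natDegree_mul hF0 h4, Nat.cast_lt]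
      omega
    · by_cases h4 : derivative F = 0
      · rw [h4, zero_mul, degree_zero]; exact WithBot.bot_lt_coe _
      have h5 := degree_derivative_lt hF0
      rw [degree_eq_natDegree h4, degree_eq_natDegree hF0, Nat.cast_lt] at h5
      rw [degree_eq_natDegree (mul_ne_zero h4 h0), natDegree_mul h4 h0, Nat.cast_lt]
      omega
  · rw [hyperellipticDeriv_im]
    refine (hC _).trans_lt ((degree_derivative_lt_pred h1).trans_le ?_)
    exact_mod_cast (by omega : n / 2 ≤ (n + (2 * g - 1) + 1) / 2 - g)

lemma iterate_hyperellipticDeriv_mem_poleSpace (hF : F.natDegree = 2 * g + 1) (hg : 1 ≤ g) {n : ℕ}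
    {h : QuadraticAlgebra K[X] F 0} (hh : h ∈ poleSpace F g n) (l : ℕ) :
    (hyperellipticDeriv F ^ l) h ∈ poleSpace F g (n + l * (2 * g - 1)) := by
  induction l with
  | zero => simpa using hh
  | succ l ih =>
    rw [pow_succ', Module.End.mul_apply, add_one_mul, ← add_assoc]
    exact hyperellipticDeriv_mem_poleSpace hF hg ih

variable (F g) in
/-- Elements of the pole space are pairs of polynomials of bounded degrees. -/
def poleSpaceEquiv (n : ℕ) :
    poleSpace F g n ≃ₗ[K] degreeLT K (n / 2 + 1) × degreeLT K ((n + 1) / 2 - g) where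
  toFun h := (⟨h.1.re, h.2.1⟩, ⟨h.1.im, h.2.2⟩)
  invFun q := ⟨⟨q.1.1, q.2.1⟩, q.1.2, q.2.2⟩
  map_add' _ _ := rfl
  map_smul' _ _ := rfl

instance (n : ℕ) : FiniteDimensional K (poleSpace F g n) :=
  have : ∀ m, FiniteDimensional K (degreeLT K m) := fun m =>
    (degreeLTEquiv K m).symm.finiteDimensional
  (poleSpaceEquiv F g n).symm.finiteDimensional

lemma finrank_poleSpace {n : ℕ} (hn : 2 * g ≤ n) :
    Module.finrank K (poleSpace F g n) = n + 1 - g := by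
  have : ∀ m, FiniteDimensional K (degreeLT K m) := fun m =>
    (degreeLTEquiv K m).symm.finiteDimensional
  have hd : ∀ m, Module.finrank K (degreeLT K m) = m := fun m => by
    rw [(degreeLTEquiv K m).finrank_eq, Module.finrank_fin_fun]
  rw [(poleSpaceEquiv F g n).finrank_eq, Module.finrank_prod, hd, hd]
  omega

end PoleSpace

section AuxiliaryFunction

variable {p : ℕ} [Fact p.Prime] {F : (ZMod p)[X]} {g : ℕ}

/-- The monomials `x ^ i` and `x ^ i * y` spanning the functions with poles of order at most `t`. -/
noncomputable def poleMonomial (F : (ZMod p)[X]) (g t : ℕ) :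
    Fin (t / 2 + 1) ⊕ Fin ((t + 1) / 2 - g) → QuadraticAlgebra (ZMod p)[X] F 0
  | .inl i => algebraMap (ZMod p)[X] _ (X ^ (i : ℕ))
  | .inr i => algebraMap (ZMod p)[X] _ (X ^ (i : ℕ)) * QuadraticAlgebra.omega

lemma poleMonomial_mem (t : ℕ) (i) : poleMonomial F g t i ∈ poleSpace F g t := by
  have key (m : ℕ) (j : Fin m) : (X ^ (j : ℕ) : (ZMod p)[X]) ∈ degreeLT (ZMod p) m := by
    rw [mem_degreeLT, degree_X_pow]; exact_mod_cast j.2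
  rcases i with i | i
  · exact ⟨by simpa [poleMonomial, -map_pow] using key _ i, by simp [poleMonomial, -map_pow]⟩
  · exact ⟨by simp [poleMonomial, -map_pow], by simpa [poleMonomial, -map_pow] using key _ i⟩

lemma poleMonomial_ne_zero (t : ℕ) (i) : poleMonomial F g t i ≠ 0 := by
  rcases i with i | i <;> intro h
  · simpa [poleMonomial, -map_pow] using congrArg QuadraticAlgebra.re h
  · simpa [poleMonomial, -map_pow] using congrArg QuadraticAlgebra.im h

lemma natDegree_norm_poleMonomial_injective (hF : F.natDegree = 2 * g + 1) (t : ℕ) :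
    Function.Injective fun i => (poleMonomial F g t i).norm.natDegree := by
  have hF0 : F ≠ 0 := by rintro rfl; simp at hF
  have h1 : ∀ i, (poleMonomial F g t (.inl i)).norm.natDegree = 2 * i := fun i => by
    simp [poleMonomial, mul_comm]
  have h2 : ∀ i, (poleMonomial F g t (.inr i)).norm.natDegree = 2 * i + (2 * g + 1) := fun i => by
    have : QuadraticAlgebra.norm (QuadraticAlgebra.omega : QuadraticAlgebra (ZMod p)[X] F 0) = -F := by
      simp [QuadraticAlgebra.norm_def]
    rw [poleMonomial, map_mul, this, QuadraticAlgebra.norm_algebraMap,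
      natDegree_mul (by simp) (by simpa), natDegree_neg, hF]
    simp [mul_comm]
  rintro (i | i) (j | j) h <;> simp only [h1, h2] at h
  · exact congrArg Sum.inl (Fin.ext (by omega))
  · omega
  · omega
  · exact congrArg Sum.inr (Fin.ext (by omega))

lemma sum_mul_pow_ne_zero (hF : F.natDegree = 2 * g + 1) {ι : Type*} [Fintype ι]
    {s e : ι → QuadraticAlgebra (ZMod p)[X] F 0} (hs : ∀ i, s i ∈ poleSpace F g (p - 1))
    (he : ∀ i, e i ≠ 0) (hinj : Function.Injective fun i => (e i).norm.natDegree)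
    (hne : ∃ i, s i ≠ 0) : ∑ i, s i * e i ^ p ≠ 0 := by
  classical
  have hp : 0 < p := (Fact.out : p.Prime).pos
  obtain ⟨i₀, hi₀, hmax⟩ := (Finset.univ.filter fun i => s i ≠ 0).exists_max_image
    (fun i => (e i).norm.natDegree) (by simpa [Finset.Nonempty] using hne)
  simp only [Finset.mem_filter, Finset.mem_univ, true_and] at hi₀ hmax
  have hdeg : ∀ i, s i ≠ 0 → (s i * e i ^ p).norm.natDegree =
      (s i).norm.natDegree + p * (e i).norm.natDegree := fun i hi => by
    rw [map_mul, map_pow, natDegree_mul (norm_ne_zero_of_odd_natDegree hF hi)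
      (pow_ne_zero _ (norm_ne_zero_of_odd_natDegree hF (he i))), natDegree_pow]
  have hlt : ∀ i, i ≠ i₀ → s i ≠ 0 → (e i).norm.natDegree < (e i₀).norm.natDegree :=
    fun i hi hsi => lt_of_le_of_ne (hmax i hsi) fun h => hi (hinj h)
  have hlead : s i₀ * e i₀ ^ p ≠ 0 := fun h => by
    have h' := congrArg QuadraticAlgebra.norm h
    rw [map_mul, map_pow, QuadraticAlgebra.norm_zero] at h'
    exact mul_ne_zero (norm_ne_zero_of_odd_natDegree hF hi₀)
      (pow_ne_zero _ (norm_ne_zero_of_odd_natDegree hF (he i₀))) h'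
  intro hsum
  rw [← Finset.add_sum_erase _ _ (Finset.mem_univ i₀)] at hsum
  by_cases hm : (e i₀).norm.natDegree = 0
  · rw [Finset.sum_eq_zero, add_zero] at hsum
    · exact hlead hsum
    · intro i hi
      by_contra hcon
      have := hlt i (Finset.ne_of_mem_erase hi) (left_ne_zero_of_mul hcon)
      omega
  · have hrest : ∑ i ∈ Finset.univ.erase i₀, s i * e i ^ p ∈
        poleSpace F g (p * (e i₀).norm.natDegree - 1) := by
      refine Submodule.sum_mem _ fun i hi => ?_
      by_cases hsi : s i = 0
      · rw [hsi, zero_mul]; exact zero_mem _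
      rw [mem_poleSpace_iff_natDegree_norm_le hF, hdeg i hsi]
      have h1 := hlt i (Finset.ne_of_mem_erase hi) hsi
      have h2 := (mem_poleSpace_iff_natDegree_norm_le hF).1 (hs i)
      have h3 := Nat.mul_le_mul_left p (Nat.succ_le_of_lt h1)
      rw [Nat.mul_succ] at h3
      omega
    rw [eq_neg_of_add_eq_zero_right hsum, Submodule.neg_mem_iff,
      mem_poleSpace_iff_natDegree_norm_le hF, hdeg i₀ hi₀] at hrest
    have := Nat.mul_pos hp (Nat.pos_of_ne_zero hm)
    omega

lemma dvd_poleMonomial_pow_sub (hp : p ≠ 2) {x₀ : ZMod p} (hx : (F.eval x₀) ^ (p / 2) = 1) (t : ℕ)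
    (i) : algebraMap (ZMod p)[X] _ (X - C x₀) ∣ poleMonomial F g t i ^ p - poleMonomial F g t i := by
  have hX : ∀ j : ℕ, algebraMap (ZMod p)[X] (QuadraticAlgebra (ZMod p)[X] F 0) (X - C x₀) ∣
      algebraMap (ZMod p)[X] _ (X ^ j) ^ p - algebraMap (ZMod p)[X] _ (X ^ j) := fun j => by
    rw [← map_pow, ← map_sub]
    refine _root_.map_dvd _ (dvd_iff_isRoot.2 ?_)
    simp [IsRoot]
  have hω : algebraMap (ZMod p)[X] (QuadraticAlgebra (ZMod p)[X] F 0) (X - C x₀) ∣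
      QuadraticAlgebra.omega ^ p - QuadraticAlgebra.omega := by
    have h1 : (QuadraticAlgebra.omega : QuadraticAlgebra (ZMod p)[X] F 0) ^ p =
        algebraMap (ZMod p)[X] _ (F ^ (p / 2)) * QuadraticAlgebra.omega := by
      have h2 : p = 2 * (p / 2) + 1 := by
        have := (Fact.out : p.Prime).eq_two_or_odd
        omega
      have h3 : (QuadraticAlgebra.omega : QuadraticAlgebra (ZMod p)[X] F 0) ^ 2 =
          algebraMap (ZMod p)[X] _ F := by
        rw [sq, QuadraticAlgebra.omega_mul_omega_eq_mk]; rfl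
      calc _ = (QuadraticAlgebra.omega : QuadraticAlgebra (ZMod p)[X] F 0) ^ (2 * (p / 2) + 1) :=
            congrArg _ h2
        _ = _ := by rw [pow_succ, pow_mul, h3, ← map_pow]
    have h4 : (QuadraticAlgebra.omega : QuadraticAlgebra (ZMod p)[X] F 0) ^ p -
        QuadraticAlgebra.omega = algebraMap (ZMod p)[X] _ (F ^ (p / 2) - 1) *
          QuadraticAlgebra.omega := by
      rw [h1, map_sub, map_one, sub_mul, one_mul]
    rw [h4]
    refine (_root_.map_dvd _ (dvd_iff_isRoot.2 ?_)).mul_right _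
    simp [IsRoot, hx]
  rcases i with i | i
  · exact hX i
  · rw [poleMonomial, mul_pow]
    convert dvd_add ((hX i).mul_right (QuadraticAlgebra.omega ^ p))
      (hω.mul_left (algebraMap (ZMod p)[X] _ (X ^ (i : ℕ)))) using 1
    ring

/-- Stepanov's auxiliary function: nonzero, of small pole order, and vanishing to order `M` at all
the points where `F` is a nonzero square. -/
lemma exists_auxiliary_function (hp : p ≠ 2) (hF : F.natDegree = 2 * g + 1) (hg : 1 ≤ g) {M : ℕ}
    (hM : 3 * g + 2 ≤ M) (hMp : M ^ 2 ≤ p) :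
    ∃ h : QuadraticAlgebra (ZMod p)[X] F 0, h ≠ 0 ∧
      h ∈ poleSpace F g (p - 1 + p * (M + 2 * g)) ∧
      ∀ x₀, (F.eval x₀) ^ (p / 2) = 1 → ∀ l < M,
        algebraMap (ZMod p)[X] _ (X - C x₀) ∣ (hyperellipticDeriv F ^ l) h := by
  set t := M + 2 * g with ht
  set e := poleMonomial F g t with he
  have hp1 : 1 ≤ p := (Fact.out : p.Prime).pos
  have hgp : 2 * g ≤ p - 1 := by
    have : M ≤ M ^ 2 := Nat.le_self_pow (by norm_num) M
    omega
  let Φ : ((Fin (t / 2 + 1) ⊕ Fin ((t + 1) / 2 - g)) → poleSpace F g (p - 1)) →ₗ[ZMod p]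
      ((l : Fin M) → poleSpace F g (p - 1 + l * (2 * g - 1) + t)) :=
    LinearMap.pi fun l => LinearMap.codRestrict _
      (∑ i, LinearMap.mulRight (ZMod p) (e i) ∘ₗ (hyperellipticDeriv F ^ (l : ℕ)) ∘ₗ
        (poleSpace F g (p - 1)).subtype ∘ₗ LinearMap.proj i) fun s => by
        rw [LinearMap.sum_apply]
        exact Submodule.sum_mem _ fun i _ => mul_mem_poleSpace hF
          (iterate_hyperellipticDeriv_mem_poleSpace hF hg (s i).2 l) (poleMonomial_mem t i)
  have hΦ : ∀ s l, (Φ s l : QuadraticAlgebra (ZMod p)[X] F 0) =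
      ∑ i, (hyperellipticDeriv F ^ (l : ℕ)) (s i).1 * e i := fun s l => by
    simp [Φ, LinearMap.sum_apply]
  have hker : LinearMap.ker Φ ≠ ⊥ := by
    apply LinearMap.ker_ne_bot_of_finrank_lt
    rw [Module.finrank_pi_fintype, Module.finrank_pi_fintype]
    have h1 : ∀ l : Fin M, Module.finrank (ZMod p) (poleSpace F g (p - 1 + l * (2 * g - 1) + t)) =
        p + M + g + l * (2 * g - 1) := fun l => by
      rw [finrank_poleSpace (by omega)]; omega
    simp only [h1, finrank_poleSpace hgp]
    rw [Fin.sum_univ_eq_sum_range (fun l => p + M + g + l * (2 * g - 1)), Finset.sum_add_distrib,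
      ← Finset.sum_mul]
    simp only [Finset.sum_const, Finset.card_range, smul_eq_mul, Finset.card_univ,
      Fintype.card_sum, Fintype.card_fin]
    have h2 := Finset.sum_range_id_mul_two M
    rw [show t / 2 + 1 + ((t + 1) / 2 - g) = M + g + 1 by omega,
      show p - 1 + 1 - g = p - g by omega]
    obtain ⟨g, rfl⟩ : ∃ k, g = k + 1 := ⟨g - 1, by omega⟩
    obtain ⟨M, rfl⟩ : ∃ k, M = k + 1 := ⟨M - 1, by omega⟩
    obtain ⟨q, rfl⟩ : ∃ q, p = q + (g + 1) := ⟨p - (g + 1), by omega⟩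
    simp only [Nat.add_sub_cancel, show 2 * (g + 1) - 1 = 2 * g + 1 by omega] at *
    nlinarith
  obtain ⟨s, hs, hs0⟩ := (Submodule.ne_bot_iff _).1 hker
  rw [LinearMap.mem_ker] at hs
  refine ⟨∑ i, (s i).1 * e i ^ p, ?_, ?_, ?_⟩
  · refine sum_mul_pow_ne_zero hF (fun i => (s i).2) (poleMonomial_ne_zero t)
      (natDegree_norm_poleMonomial_injective hF t) ?_
    by_contra! hcon
    exact hs0 (funext fun i => Subtype.ext (hcon i))
  · refine Submodule.sum_mem _ fun i _ => mul_mem_poleSpace hF (s i).2 ?_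
    rw [mem_poleSpace_iff_natDegree_norm_le hF, map_pow, natDegree_pow]
    exact Nat.mul_le_mul_left p
      ((mem_poleSpace_iff_natDegree_norm_le hF).1 (poleMonomial_mem t i))
  · intro x₀ hx l hl
    have h0 : ∑ i, (hyperellipticDeriv F ^ l) (s i).1 * e i = 0 := by
      rw [← hΦ s ⟨l, hl⟩, hs]; rfl
    have h1 : (hyperellipticDeriv F ^ l) (∑ i, (s i).1 * e i ^ p) =
        ∑ i, (hyperellipticDeriv F ^ l) (s i).1 * (e i ^ p - e i) := by
      simp only [map_sum, iterate_hyperellipticDeriv_mul_pow, mul_sub, Finset.sum_sub_distrib, h0,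
        sub_zero]
    rw [h1]
    exact Finset.dvd_sum fun i _ => (dvd_poleMonomial_pow_sub hp hx t i).mul_left _

lemma card_eval_square_le (hp : 2 < p) (hF : F.natDegree = 2 * g + 1) (hg : 1 ≤ g) {M : ℕ}
    (hM : 3 * g + 2 ≤ M) (hMp : M ^ 2 ≤ p) :
    2 * M * (Finset.univ.filter fun x => (F.eval x) ^ (p / 2) = 1).card ≤
      p * (M + 2 * g + 1) := by
  obtain ⟨h, h0, hmem, hvan⟩ := exists_auxiliary_function (by omega) hF hg hM hMp
  have hn0 := norm_ne_zero_of_odd_natDegree hF h0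
  have hdeg := (mem_poleSpace_iff_natDegree_norm_le hF).1 hmem
  have hdvd : ∏ x ∈ Finset.univ.filter (fun x => (F.eval x) ^ (p / 2) = 1), (X - C x) ^ (2 * M) ∣
      h.norm := by
    refine Finset.prod_dvd_of_coprime (fun x _ y _ hxy => ?_) fun x hx => ?_
    · exact (pairwise_coprime_X_sub_C Function.injective_id hxy).pow
    · rw [Finset.mem_filter] at hx
      obtain ⟨w, rfl⟩ := X_sub_C_pow_dvd_of_iterate p hp (x₀ := x) (fun h => by
        rw [h, zero_pow (by omega)] at hx; exact zero_ne_one hx.2)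
        ((Nat.le_self_pow (by norm_num) M).trans hMp) (hvan x hx.2)
      rw [map_mul, map_pow, QuadraticAlgebra.norm_algebraMap, ← pow_mul]
      exact dvd_mul_right _ _
  have h1 := natDegree_le_of_dvd hdvd hn0
  rw [natDegree_prod_of_monic _ _ fun x _ => (monic_X_sub_C x).pow _] at h1
  simp only [natDegree_pow, natDegree_X_sub_C, mul_one, Finset.sum_const, smul_eq_mul] at h1
  calc _ = (Finset.univ.filter fun x => (F.eval x) ^ (p / 2) = 1).card * (2 * M) := mul_comm _ _
    _ ≤ p - 1 + p * (M + 2 * g) := h1.trans hdeg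
    _ ≤ p + p * (M + 2 * g) := by omega
    _ = _ := by ring

end AuxiliaryFunction

section CharacterSum

variable {p : ℕ} [Fact p.Prime]

/-- A Weil-type bound for the sums of the quadratic character over a polynomial of odd degree. -/
lemma mul_sum_quadraticChar_eval_le (hp : 2 < p) {F : (ZMod p)[X]} {g : ℕ}
    (hF : F.natDegree = 2 * g + 1) (hg : 1 ≤ g) {M : ℕ} (hM : 3 * g + 2 ≤ M) (hMp : M ^ 2 ≤ p) :
    (M : ℤ) * ∑ x, quadraticChar (ZMod p) (F.eval x) ≤ (2 * g + 1) * (p + M) := by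
  have hF0 : F ≠ 0 := by rintro rfl; simp at hF
  have hpt : ∀ x, quadraticChar (ZMod p) (F.eval x) =
      2 * (if (F.eval x) ^ (p / 2) = 1 then 1 else 0) - 1 + (if F.eval x = 0 then 1 else 0) := by
    intro x
    by_cases hx : F.eval x = 0
    · simp [hx, show p / 2 ≠ 0 by omega]
    · rw [quadraticChar_eq_pow_of_char_ne_two (by rw [ZMod.ringChar_zmod_n]; omega) hx, ZMod.card]
      split_ifs <;> norm_num
  have hroots : (Finset.univ.filter fun x => F.eval x = 0).card ≤ 2 * g + 1 := by
    rw [← hF]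
    refine le_trans (Finset.card_le_card fun x hx => ?_) (F.roots.toFinset_card_le.trans
      F.card_roots')
    simpa [hF0] using hx
  have hcard := card_eval_square_le hp hF hg hM hMp
  have hsum : ∑ x, quadraticChar (ZMod p) (F.eval x) =
      2 * ((Finset.univ.filter fun x => (F.eval x) ^ (p / 2) = 1).card : ℤ) - p +
        (Finset.univ.filter fun x => F.eval x = 0).card := by
    simp only [hpt, Finset.sum_add_distrib, Finset.sum_sub_distrib, ← Finset.mul_sum,
      Finset.sum_boole]
    simp [ZMod.card]
  rw [hsum]
  zify at hcard hroots
  nlinarith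

lemma sum_prod_quadraticChar_eq (W : Finset (ZMod p)) (hW : Even W.card) {z₀ : ZMod p}
    (hz : z₀ ∈ W) :
    ∑ x, ∏ z ∈ W, quadraticChar (ZMod p) (x - z) =
      ∑ w, quadraticChar (ZMod p) ((∏ z ∈ W.erase z₀, (1 - C (z - z₀) * X)).eval w) - 1 := by
  have h1 : ∑ x, ∏ z ∈ W, quadraticChar (ZMod p) (x - z) =
      ∑ w : ZMod p, ∏ z ∈ W, quadraticChar (ZMod p) (z₀ + w⁻¹ - z) :=
    (Fintype.sum_equiv ((Equiv.inv (ZMod p)).trans (Equiv.addLeft z₀)) _ _ fun w => by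
      simp only [Equiv.trans_apply, Equiv.inv_apply, Equiv.coe_addLeft]).symm
  have h2 : ∀ w : ZMod p, ∏ z ∈ W, quadraticChar (ZMod p) (z₀ + w⁻¹ - z) =
      quadraticChar (ZMod p) ((∏ z ∈ W.erase z₀, (1 - C (z - z₀) * X)).eval w) -
        if w = 0 then 1 else 0 := by
    intro w
    by_cases hw : w = 0
    · rw [Finset.prod_eq_zero hz (by simp [hw])]
      simp [hw, eval_prod]
    · have h3 : ∀ z, quadraticChar (ZMod p) (z₀ + w⁻¹ - z) =
          quadraticChar (ZMod p) w⁻¹ * quadraticChar (ZMod p) (1 - (z - z₀) * w) := fun z => by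
        rw [← map_mul]
        congr 1
        field_simp
        ring
      simp only [h3, Finset.prod_mul_distrib, Finset.prod_const]
      obtain ⟨k, hk⟩ := hW
      rw [← Finset.mul_prod_erase W _ hz, hk, ← two_mul, pow_mul,
        quadraticChar_sq_one (inv_ne_zero hw)]
      simp [hw, eval_prod]
  rw [h1]
  simp only [h2, Finset.sum_sub_distrib, Finset.sum_ite_eq', Finset.mem_univ, if_true]

lemma natDegree_prod_one_sub_C_mul_X (W : Finset (ZMod p)) (z₀ : ZMod p) :
    (∏ z ∈ W.erase z₀, (1 - C (z - z₀) * X)).natDegree = (W.erase z₀).card := by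
  have h1 : ∀ z ∈ W.erase z₀, (1 - C (z - z₀) * X).natDegree = 1 := fun z hz => by
    have hne : z - z₀ ≠ 0 := sub_ne_zero.2 (Finset.ne_of_mem_erase hz)
    rw [show (1 : (ZMod p)[X]) - C (z - z₀) * X = C (-(z - z₀)) * X + C 1 by simp; ring]
    exact natDegree_linear (neg_ne_zero.2 hne)
  rw [natDegree_prod _ _ fun z hz h0 => by
      have := h1 z hz
      rw [h0, natDegree_zero] at this
      exact absurd this (by norm_num),
    Finset.sum_congr rfl h1, Finset.sum_const, smul_eq_mul, mul_one]

lemma sum_quadraticChar_mul_of_ne (hp : 2 < p) {a b : ZMod p} (hab : a ≠ b) :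
    ∑ x, quadraticChar (ZMod p) (x - a) * quadraticChar (ZMod p) (x - b) = -1 := by
  have h := sum_prod_quadraticChar_eq {a, b} (by simp [Finset.card_pair hab]) (z₀ := a) (by simp)
  simp only [Finset.prod_pair hab] at h
  rw [h, show ({a, b} : Finset (ZMod p)).erase a = {b} by
    rw [Finset.erase_insert]; simpa using hab]
  have hne : -(b - a) ≠ 0 := neg_ne_zero.2 (sub_ne_zero.2 hab.symm)
  have h1 : ∑ w : ZMod p, quadraticChar (ZMod p) (1 + -(b - a) * w) =
      ∑ x, quadraticChar (ZMod p) x :=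
    Fintype.sum_equiv ((Equiv.mulLeft₀ _ hne).trans (Equiv.addLeft 1)) _ _ fun w => rfl
  simp only [Finset.prod_singleton, eval_sub, eval_mul, eval_C, eval_X, eval_one]
  simp only [neg_mul, ← sub_eq_add_neg] at h1
  rw [h1, quadraticChar_sum_zero (by rw [ZMod.ringChar_zmod_n]; omega)]
  norm_num

lemma sum_prod_quadraticChar_le (hp : 2 < p) (W : Finset (ZMod p)) (hW : Even W.card)
    (hne : W.Nonempty) (hlarge : (W.card : ℝ) ^ 2 ≤ √p) :
    ((∑ x, ∏ z ∈ W, quadraticChar (ZMod p) (x - z) : ℤ) : ℝ) ≤ W.card * √p := by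
  obtain ⟨k, hk⟩ := hW
  have hpos := hne.card_pos
  obtain ⟨g, rfl⟩ : ∃ g, k = g + 1 := ⟨k - 1, by omega⟩
  rcases Nat.eq_zero_or_pos g with rfl | hg
  · obtain ⟨a, b, hab, rfl⟩ := Finset.card_eq_two.1 hk
    simp only [Finset.prod_pair hab]
    rw [sum_quadraticChar_mul_of_ne hp hab]
    push_cast
    have : (0 : ℝ) ≤ (({a, b} : Finset (ZMod p)).card : ℝ) * √p := by positivity
    linarith
  obtain ⟨z₀, hz⟩ := hne
  have hWc : W.card = 2 * g + 2 := by omega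
  have hdeg := natDegree_prod_one_sub_C_mul_X W z₀
  rw [Finset.card_erase_of_mem hz, hWc] at hdeg
  rw [sum_prod_quadraticChar_eq W ⟨g + 1, hk⟩ hz]
  set S := ∑ w, quadraticChar (ZMod p) ((∏ z ∈ W.erase z₀, (1 - C (z - z₀) * X)).eval w)
  set s := √(p : ℝ) with hs
  have hss : s * s = p := Real.mul_self_sqrt (by positivity)
  have hMs : (Nat.sqrt p : ℝ) ≤ s := Real.nat_sqrt_le_real_sqrt
  have hsM : s ≤ Nat.sqrt p + 1 := Real.real_sqrt_le_nat_sqrt_succ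
  set M := Nat.sqrt p
  rw [hWc] at hlarge ⊢
  push_cast at hlarge ⊢
  have hgR : (1 : ℝ) ≤ g := by exact_mod_cast hg
  have hM : (4 * g + 2 : ℝ) ≤ M := by nlinarith
  have hMnat : 3 * g + 2 ≤ M := by
    have : 4 * g + 2 ≤ M := by exact_mod_cast hM
    omega
  have hmain : (M : ℝ) * S ≤ (2 * g + 1) * (p + M) := by
    exact_mod_cast mul_sum_quadraticChar_eval_le hp hdeg hg hMnat (Nat.sqrt_le' p)
  have hMpos : (0 : ℝ) < M := by linarith
  refine le_of_mul_le_mul_left ?_ hMpos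
  have h1 : (p : ℝ) ≤ M * s + s := by nlinarith
  have h2 : (4 * g + 2 : ℝ) * s ≤ M * s := by gcongr
  have h3 : (2 * g + 1 : ℝ) * (p + M) ≤ (2 * g + 1) * (M * s + s + s) := by gcongr
  nlinarith

lemma abs_quadraticChar_le_one (a : ZMod p) : |quadraticChar (ZMod p) a| ≤ 1 := by
  by_cases ha : a = 0
  · simp [ha]
  · rcases quadraticChar_dichotomy ha with h | h <;> simp [h]

lemma sum_prod_quadraticChar_tuple_le (hp : 2 < p) {n : ℕ} (hn : Even n) (τ : Fin n → ZMod p)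
    (hlarge : ((Finset.univ.image τ).card * n : ℝ) ≤ √p)
    (hodd : ∃ z, Odd (Finset.univ.filter fun i => τ i = z).card) :
    ((∑ x, ∏ i, quadraticChar (ZMod p) (x - τ i) : ℤ) : ℝ) ≤ n * √p := by
  set W := (Finset.univ.image τ).filter fun z => Odd (Finset.univ.filter fun i => τ i = z).card
    with hWdef
  have hWsub : W ⊆ Finset.univ.image τ := Finset.filter_subset _ _
  have himg : (Finset.univ.image τ).card ≤ n := by
    simpa using Finset.card_image_le (s := Finset.univ) (f := τ)
  have hWc := Finset.card_le_card hWsub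
  have hWeven : Even W.card := by
    rw [← Nat.not_odd_iff_even, hWdef, ← Finset.odd_sum_iff_odd_card_odd,
      ← Finset.card_eq_sum_card_image, Nat.not_odd_iff_even]
    simpa using hn
  have hWne : W.Nonempty := by
    obtain ⟨z, hz⟩ := hodd
    refine ⟨z, Finset.mem_filter.2 ⟨?_, hz⟩⟩
    obtain ⟨i, hi⟩ := Finset.card_pos.1 hz.pos
    exact Finset.mem_image.2 ⟨i, Finset.mem_univ _, (Finset.mem_filter.1 hi).2⟩
  have hpt : ∀ x, ∏ i, quadraticChar (ZMod p) (x - τ i) ≤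
      ∏ z ∈ W, quadraticChar (ZMod p) (x - z) +
        if x ∈ Finset.univ.image τ \ W then 1 else 0 := by
    intro x
    by_cases hx : x ∈ Finset.univ.image τ
    · obtain ⟨i, -, rfl⟩ := Finset.mem_image.1 hx
      rw [Finset.prod_eq_zero (Finset.mem_univ i) (by simp)]
      by_cases hxW : τ i ∈ W
      · rw [Finset.prod_eq_zero hxW (by simp)]
        split_ifs <;> simp
      · rw [if_pos (Finset.mem_sdiff.2 ⟨hx, hxW⟩)]
        have : |∏ z ∈ W, quadraticChar (ZMod p) (τ i - z)| ≤ 1 := by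
          rw [Finset.abs_prod]
          exact Finset.prod_le_one (fun _ _ => abs_nonneg _) fun _ _ =>
          abs_quadraticChar_le_one _
        linarith [(abs_le.1 this).1]
    · rw [if_neg fun h => hx (Finset.mem_sdiff.1 h).1, add_zero,
        Finset.prod_comp (fun z => quadraticChar (ZMod p) (x - z)) τ, hWdef, Finset.prod_filter]
      refine (Finset.prod_congr rfl fun z hz => ?_).le
      have hxz : x - z ≠ 0 := sub_ne_zero.2 fun h => hx (h ▸ hz)
      split_ifs with ho
      · obtain ⟨k, hk⟩ := ho
        rw [hk, pow_succ, pow_mul, quadraticChar_sq_one hxz, one_pow, one_mul]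
      · obtain ⟨k, hk⟩ := Nat.not_odd_iff_even.1 ho
        rw [hk, ← two_mul, pow_mul, quadraticChar_sq_one hxz, one_pow]
  have hsum : ∑ x, ∏ i, quadraticChar (ZMod p) (x - τ i) ≤
      ∑ x, ∏ z ∈ W, quadraticChar (ZMod p) (x - z) + ((n : ℤ) - W.card) := by
    refine (Finset.sum_le_sum fun x _ => hpt x).trans ?_
    rw [Finset.sum_add_distrib]
    simp only [Finset.sum_boole, Finset.filter_univ_mem]
    rw [Finset.card_sdiff_of_subset hWsub]
    gcongr
    push_cast [Nat.cast_sub hWc]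
    gcongr
  have hWR : (W.card : ℝ) ≤ (Finset.univ.image τ).card := by exact_mod_cast hWc
  have hWn : (W.card : ℝ) ≤ n := by exact_mod_cast hWc.trans himg
  have hW := sum_prod_quadraticChar_le hp W hWeven hWne (by
    refine le_trans ?_ hlarge
    rw [sq]
    gcongr)
  have hs1 : 1 ≤ √(p : ℝ) := Real.one_le_sqrt.2 (by exact_mod_cast (by omega : 1 ≤ p))
  have hsumR : ((∑ x, ∏ i, quadraticChar (ZMod p) (x - τ i) : ℤ) : ℝ) ≤
      ((∑ x, ∏ z ∈ W, quadraticChar (ZMod p) (x - z) : ℤ) : ℝ) + ((n : ℝ) - W.card) := by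
    exact_mod_cast hsum
  nlinarith

end CharacterSum

section EvenTuples

variable {α : Type*} [Fintype α] [DecidableEq α]

/-- The tuples in which every value is taken an even number of times. -/
def evenTuples (α : Type*) [Fintype α] [DecidableEq α] (n : ℕ) : Finset (Fin n → α) :=
  Finset.univ.filter fun τ => ∀ z, Even (Finset.univ.filter fun i => τ i = z).card

lemma mem_evenTuples {n : ℕ} {τ : Fin n → α} :
    τ ∈ evenTuples α n ↔ ∀ z, Even (Finset.univ.filter fun i => τ i = z).card := by
  simp [evenTuples]

lemma card_evenTuples_add_two_le (n : ℕ) :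
    (evenTuples α (n + 2)).card ≤ (n + 1) * Fintype.card α * (evenTuples α n).card := by
  have hsub : evenTuples α (n + 2) ⊆
      ((Finset.univ : Finset (Fin (n + 1) × α)) ×ˢ evenTuples α n).image fun q =>
        Fin.cons q.1.2 (Fin.insertNth (α := fun _ => α) q.1.1 q.1.2 q.2) := by
    intro τ hτ
    rw [mem_evenTuples] at hτ
    have hcount : ∀ z, (Finset.univ.filter fun i => τ i = z).card =
        (if τ 0 = z then 1 else 0) + (Finset.univ.filter fun i => Fin.tail τ i = z).card := by
      intro z
      rw [Finset.card_filter, Finset.card_filter, Fin.sum_univ_succ]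
      rfl
    obtain ⟨j, hj⟩ : ∃ j, Fin.tail τ j = τ 0 := by
      by_contra! hcon
      have h := hτ (τ 0)
      rw [hcount, Finset.filter_false_of_mem fun i _ => hcon i] at h
      simp at h
    refine Finset.mem_image.2 ⟨((j, τ 0), j.removeNth (Fin.tail τ)), ?_, ?_⟩
    · simp only [Finset.mem_product, Finset.mem_univ, true_and, mem_evenTuples]
      intro z
      have h := hτ z
      have htail : (Finset.univ.filter fun i => Fin.tail τ i = z).card =
          (if τ 0 = z then 1 else 0) +
            (Finset.univ.filter fun i => j.removeNth (Fin.tail τ) i = z).card := by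
        rw [Finset.card_filter, Finset.card_filter, Fin.sum_univ_succAbove _ j, hj]
        rfl
      rw [hcount, htail, ← add_assoc, ← two_mul, Nat.even_add] at h
      exact h.1 (even_two_mul _)
    · rw [← hj, Fin.insertNth_self_removeNth, hj, Fin.cons_self_tail]
  refine (Finset.card_le_card hsub).trans (Finset.card_image_le.trans ?_)
  simp [Finset.card_product]

lemma card_evenTuples_mul_le (R : ℕ) :
    (evenTuples α (2 * R)).card * (2 ^ R * R.factorial) ≤
      (2 * R).factorial * Fintype.card α ^ R := by
  induction R with
  | zero => simpa using Finset.card_le_univ (evenTuples α 0)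
  | succ R ih =>
    have h := card_evenTuples_add_two_le (α := α) (2 * R)
    rw [mul_add_one, Nat.factorial_succ (2 * R + 1), Nat.factorial_succ (2 * R),
      Nat.factorial_succ R, pow_succ, pow_succ]
    calc _ ≤ (2 * R + 1) * Fintype.card α * (evenTuples α (2 * R)).card *
          (2 ^ R * 2 * ((R + 1) * R.factorial)) := by gcongr
      _ = (2 * R + 1) * Fintype.card α * (2 * (R + 1)) *
          ((evenTuples α (2 * R)).card * (2 ^ R * R.factorial)) := by ring
      _ ≤ (2 * R + 1) * Fintype.card α * (2 * (R + 1)) *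
          ((2 * R).factorial * Fintype.card α ^ R) := by gcongr
      _ = _ := by ring

end EvenTuples

section Moments

variable {p : ℕ} [Fact p.Prime]

lemma second_moment_le (hp : 2 < p) (Z : Finset (ZMod p)) :
    ∑ x, (∑ z ∈ Z, quadraticChar (ZMod p) (x - z)) ^ 2 ≤ Z.card * p := by
  simp only [sq, Finset.sum_mul_sum]
  rw [Finset.sum_comm]
  have h : ∀ a ∈ Z, ∑ x, ∑ b ∈ Z, quadraticChar (ZMod p) (x - a) * quadraticChar (ZMod p) (x - b)
      ≤ p := by
    intro a ha
    rw [Finset.sum_comm, ← Finset.add_sum_erase _ _ ha]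
    have h1 : ∑ x, quadraticChar (ZMod p) (x - a) * quadraticChar (ZMod p) (x - a) ≤ p := by
      calc _ ≤ ∑ _x : ZMod p, (1 : ℤ) := Finset.sum_le_sum fun x _ => by
            rw [← abs_mul_abs_self]
            exact mul_le_one₀ (abs_quadraticChar_le_one _) (abs_nonneg _)
              (abs_quadraticChar_le_one _)
        _ = p := by simp
    have h2 : ∑ b ∈ Z.erase a, ∑ x, quadraticChar (ZMod p) (x - a) * quadraticChar (ZMod p) (x - b)
        ≤ 0 := Finset.sum_nonpos fun b hb => by
      rw [sum_quadraticChar_mul_of_ne hp (Finset.ne_of_mem_erase hb).symm]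
      norm_num
    linarith
  calc _ ≤ ∑ _a ∈ Z, (p : ℤ) := Finset.sum_le_sum h
    _ = _ := by simp

lemma moment_le_of_sqrt_le (hp : 2 < p) (Z : Finset (ZMod p)) {R : ℕ} (hR : 0 < R)
    (hsmall : √p ≤ 2 * R * Z.card) :
    ((∑ x, (∑ z ∈ Z, quadraticChar (ZMod p) (x - z)) ^ (2 * R) : ℤ) : ℝ) ≤
      2 * R * (Z.card : ℝ) ^ (2 * R) * √p := by
  obtain ⟨r, rfl⟩ : ∃ r, R = r + 1 := ⟨R - 1, by omega⟩
  have h1 : ∑ x, (∑ z ∈ Z, quadraticChar (ZMod p) (x - z)) ^ (2 * (r + 1)) ≤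
      (Z.card : ℤ) ^ (2 * r) * (Z.card * p) := by
    refine le_trans ?_ (mul_le_mul_of_nonneg_left (second_moment_le hp Z) (by positivity))
    rw [Finset.mul_sum]
    refine Finset.sum_le_sum fun x _ => ?_
    rw [mul_add_one, pow_add]
    refine mul_le_mul_of_nonneg_right ?_ (sq_nonneg _)
    rw [pow_mul, pow_mul]
    refine pow_le_pow_left₀ (sq_nonneg _) (sq_le_sq' ?_ ?_) r
    all_goals
      have : |∑ z ∈ Z, quadraticChar (ZMod p) (x - z)| ≤ Z.card :=
        (Finset.abs_sum_le_sum_abs _ _).trans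
          ((Finset.sum_le_sum fun z _ => abs_quadraticChar_le_one _).trans (by simp))
      linarith [(abs_le.1 this).1, (abs_le.1 this).2]
  have h2 : ((∑ x, (∑ z ∈ Z, quadraticChar (ZMod p) (x - z)) ^ (2 * (r + 1)) : ℤ) : ℝ) ≤
      (Z.card : ℝ) ^ (2 * r) * (Z.card * p) := by exact_mod_cast h1
  refine h2.trans ?_
  have hss : √(p : ℝ) * √p = p := Real.mul_self_sqrt (by positivity)
  calc (Z.card : ℝ) ^ (2 * r) * (Z.card * p)
      = (Z.card : ℝ) ^ (2 * r) * (Z.card * (√p * √p)) := by rw [hss]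
    _ ≤ (Z.card : ℝ) ^ (2 * r) * (Z.card * ((2 * (r + 1 : ℕ) * Z.card) * √p)) := by gcongr
    _ = _ := by ring

lemma moment_le (hp : 2 < p) (Z : Finset (ZMod p)) {R : ℕ} (hR : 0 < R) :
    ((∑ x, (∑ z ∈ Z, quadraticChar (ZMod p) (x - z)) ^ (2 * R) : ℤ) : ℝ) ≤
      ((2 * R).factorial : ℝ) / (2 ^ R * R.factorial) * (Z.card : ℝ) ^ R * p +
        2 * R * (Z.card : ℝ) ^ (2 * R) * √p := by
  rcases le_total √(p : ℝ) (2 * R * Z.card) with hsmall | hlarge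
  · exact (moment_le_of_sqrt_le hp Z hR hsmall).trans (le_add_of_nonneg_left (by positivity))
  have hexp : ∑ x, (∑ z ∈ Z, quadraticChar (ZMod p) (x - z)) ^ (2 * R) =
      ∑ τ : Fin (2 * R) → Z, ∑ x, ∏ i, quadraticChar (ZMod p) (x - τ i) := by
    rw [Finset.sum_comm]
    refine Finset.sum_congr rfl fun x _ => ?_
    rw [← Finset.sum_coe_sort, Fintype.sum_pow]
  have hτ : ∀ τ : Fin (2 * R) → Z,
      ((∑ x, ∏ i, quadraticChar (ZMod p) (x - τ i) : ℤ) : ℝ) ≤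
        (if τ ∈ evenTuples Z (2 * R) then (p : ℝ) else 0) + 2 * R * √p := by
    intro τ
    split_ifs with h
    · have h1 : ∑ x, ∏ i, quadraticChar (ZMod p) (x - τ i) ≤ p := by
        calc _ ≤ ∑ _x : ZMod p, (1 : ℤ) := Finset.sum_le_sum fun x _ => by
              refine (le_abs_self _).trans ?_
              rw [Finset.abs_prod]
              exact Finset.prod_le_one (fun _ _ => abs_nonneg _) fun _ _ =>
                abs_quadraticChar_le_one _
          _ = p := by simp
      have h2 : ((∑ x, ∏ i, quadraticChar (ZMod p) (x - τ i) : ℤ) : ℝ) ≤ p := by exact_mod_cast h1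
      have : 0 ≤ 2 * R * √(p : ℝ) := by positivity
      linarith
    · rw [mem_evenTuples] at h
      push Not at h
      obtain ⟨z, hz⟩ := h
      have himg : (Finset.univ.image fun i => (τ i : ZMod p)).card ≤ Z.card :=
        Finset.card_le_card (Finset.image_subset_iff.2 fun i _ => (τ i).2)
      have := sum_prod_quadraticChar_tuple_le hp (even_two_mul R) (fun i => (τ i : ZMod p)) (by
        refine le_trans ?_ hlarge
        push_cast
        rw [mul_comm]
        gcongr) ⟨z, by simpa using hz⟩
      push_cast at this ⊢
      linarith
  have hcard : ((evenTuples Z (2 * R)).card : ℝ) ≤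
      ((2 * R).factorial : ℝ) / (2 ^ R * R.factorial) * (Z.card : ℝ) ^ R := by
    rw [div_mul_eq_mul_div, le_div_iff₀ (by positivity)]
    have := card_evenTuples_mul_le (α := Z) R
    rw [Fintype.card_coe] at this
    exact_mod_cast this
  rw [hexp, Int.cast_sum]
  refine (Finset.sum_le_sum fun τ _ => hτ τ).trans ?_
  rw [Finset.sum_add_distrib, ← Finset.sum_filter, Finset.filter_univ_mem]
  simp only [Finset.sum_const, Finset.card_univ, Fintype.card_fun, Fintype.card_fin,
    Fintype.card_coe, nsmul_eq_mul]
  push_cast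
  have h1 : ((evenTuples Z (2 * R)).card : ℝ) * p ≤
      ((2 * R).factorial : ℝ) / (2 ^ R * R.factorial) * (Z.card : ℝ) ^ R * p := by gcongr
  linarith

lemma sum_Icc_intCast (f : ZMod p → ℤ) :
    ∑ n ∈ Finset.Icc (1 : ℤ) p, f n = ∑ x, f x := by
  have hinj : Set.InjOn (fun n : ℤ => (n : ZMod p)) (Finset.Icc (1 : ℤ) p) := by
    intro a ha b hb hab
    simp only [Finset.coe_Icc, Set.mem_Icc] at ha hb
    have h := (ZMod.intCast_eq_intCast_iff_dvd_sub a b p).1 hab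
    have := Int.eq_zero_of_abs_lt_dvd h (by rw [abs_lt]; constructor <;> linarith)
    linarith
  rw [← Finset.sum_image (f := f) hinj]
  refine Finset.sum_congr (Finset.eq_univ_of_card _ ?_) fun _ _ => rfl
  rw [Finset.card_image_of_injOn hinj, ZMod.card]
  simp

end Moments


/-- Let `p` be an odd prime, `Z` a finite set of integers in distinct residue classes mod `p`,
and `R ≥ 1`. Then the `2R`-th moment of the incomplete character sum satisfies
`∑_{n=1}^{p} (∑_{z ∈ Z} ((n - z)/p))^{2R} ≤ ((2R)!/(2^R R!)) |Z|^R p + 2R |Z|^{2R} √p`. -/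
theorem moment_bound_incomplete_character_sum (p : ℕ) [Fact p.Prime] (hp : 2 < p)
    (Z : Finset ℤ) (hZ : ∀ z₁ ∈ Z, ∀ z₂ ∈ Z, z₁ ≡ z₂ [ZMOD (p : ℤ)] → z₁ = z₂)
    (R : ℕ) (hR : 0 < R) :
    ((∑ n ∈ Finset.Icc (1 : ℤ) (p : ℤ), (∑ z ∈ Z, legendreSym p (n - z)) ^ (2 * R) : ℤ) : ℝ) ≤
      ((2 * R).factorial : ℝ) / (2 ^ R * R.factorial) * (Z.card : ℝ) ^ R * p +
        2 * R * (Z.card : ℝ) ^ (2 * R) * Real.sqrt p := by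
  classical
  have hinj : Set.InjOn (fun z : ℤ => (z : ZMod p)) Z := fun a ha b hb hab =>
    hZ a ha b hb ((ZMod.intCast_eq_intCast_iff a b p).1 hab)
  have h := moment_le hp (Z.image fun z : ℤ => (z : ZMod p)) hR
  rw [Finset.card_image_of_injOn hinj] at h
  convert h using 2
  rw [← sum_Icc_intCast]
  refine Finset.sum_congr rfl fun n _ => ?_
  rw [Finset.sum_image hinj]
  simp [legendreSym]
end
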